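/- arXiv:2006.05973 — 2 statements merged into one kernel-verified Lean document; each statement's English description precedes it below -/
import Mathlib

section
/- Assume φ'(∞) = +∞. Let ν be a probability measure on (Ω,F) and g : Ω → ℝ measurable with Λ_{g,ν}(t) < ∞ for every t ∈ ℝ (g is strongly (φ,ν)-subexponential). Then the function ε ↦ inf{ D_φ(μ‖ν) : μ a probability measure with μ ≪ ν, g ∈ L¹(μ), and ∫ g dμ − ∫ g dν = ε } is lower semicontinuous on ℝ (inf ∅ = +∞). -/
open MeasureTheory Filter Set
open scoped ENNReal NNReal Topology

/-- Map an extended real to `ℝ≥0∞`, sending `⊤` to `⊤` and negative values to `0`. -/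
noncomputable def erealToENNReal (x : EReal) : ℝ≥0∞ :=
  if x = ⊤ then ⊤ else ENNReal.ofReal x.toReal

/-- `ψ*(y) = sup_{x ∈ ℝ} (x·y − φ(x+1))`, the convex conjugate of `ψ(x) := φ(x+1)`.
Since `φ 1 = 0`, the supremum is nonnegative (take `x = 0`), so we record it in `ℝ≥0∞`. -/
noncomputable def psiStar (φ : ℝ → ℝ≥0∞) (y : ℝ) : ℝ≥0∞ :=
  erealToENNReal (⨆ x : ℝ, ((x * y : ℝ) : EReal) - ((φ (x + 1) : ℝ≥0∞) : EReal))

/-- The `(φ,ν)`-cumulant generating function `Λ_{g,ν}(t) = inf_{λ ∈ ℝ} ∫ ψ*(t·g + λ) dν`. -/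
noncomputable def cgf {Ω : Type*} [MeasurableSpace Ω] (φ : ℝ → ℝ≥0∞)
    (ν : Measure Ω) (g : Ω → ℝ) (t : ℝ) : ℝ≥0∞ :=
  ⨅ lam : ℝ, ∫⁻ ω, psiStar φ (t * g ω + lam) ∂ν

/-- The φ-divergence `D_φ(μ‖ν) = ∫ φ(dμ/dν) dν` for `μ ≪ ν`. -/
noncomputable def divAC {Ω : Type*} [MeasurableSpace Ω] (φ : ℝ → ℝ≥0∞)
    (μ ν : Measure Ω) : ℝ≥0∞ :=
  ∫⁻ ω, φ ((μ.rnDeriv ν ω).toReal) ∂ν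

theorem psiStar_measurable (φ : ℝ → ℝ≥0∞) : Measurable (psiStar φ) := by
  have h1 : LowerSemicontinuous (fun y : ℝ =>
      ⨆ x : ℝ, ((x * y : ℝ) : EReal) - ((φ (x + 1) : ℝ≥0∞) : EReal)) := by
    refine lowerSemicontinuous_iSup fun x => ?_
    apply Continuous.lowerSemicontinuous
    by_cases hx : φ (x + 1) = ⊤
    · simp only [hx, EReal.coe_ennreal_top, EReal.sub_top]
      exact continuous_const
    · have : (fun y : ℝ => ((x * y : ℝ) : EReal) - ((φ (x + 1) : ℝ≥0∞) : EReal))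
          = fun y : ℝ => ((x * y - (φ (x+1)).toReal : ℝ) : EReal) := by
        funext y
        rw [EReal.coe_sub, EReal.coe_ennreal_toReal hx]
      rw [this]
      exact continuous_coe_real_ereal.comp (by fun_prop)
  exact measurable_ereal_toENNReal.comp h1.measurable

theorem psiStar_young (φ : ℝ → ℝ≥0∞) (h l : ℝ) :
    ENNReal.ofReal ((h - 1) * l) ≤ φ h + psiStar φ l := by
  by_cases hh : φ h = ⊤
  · simp [hh]
  have h1 : (((h - 1) * l - (φ h).toReal : ℝ) : EReal) ≤
      ⨆ x : ℝ, ((x * l : ℝ) : EReal) - ((φ (x + 1) : ℝ≥0∞) : EReal) := by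
    refine le_iSup_of_le (h - 1) ?_
    rw [sub_add_cancel, EReal.coe_sub, EReal.coe_ennreal_toReal hh]
  have h2 : ENNReal.ofReal ((h - 1) * l - (φ h).toReal) ≤ psiStar φ l := by
    have := EReal.toENNReal_le_toENNReal h1
    rw [EReal.toENNReal_of_ne_top (EReal.coe_ne_top _), EReal.toReal_coe] at this
    exact this
  calc ENNReal.ofReal ((h - 1) * l)
      = ENNReal.ofReal ((φ h).toReal + ((h - 1) * l - (φ h).toReal)) := by ring_nf
    _ ≤ ENNReal.ofReal (φ h).toReal + ENNReal.ofReal ((h - 1) * l - (φ h).toReal) :=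
        ENNReal.ofReal_add_le
    _ ≤ φ h + psiStar φ l := by
        rw [ENNReal.ofReal_toReal hh]; gcongr

theorem psiStar_ne_top (φ : ℝ → ℝ≥0∞) (hneg : ∀ x : ℝ, x < 0 → φ x = ⊤)
    (hdphi : Tendsto (fun x : ℝ => φ x / ENNReal.ofReal x) atTop (𝓝 ⊤)) (l : ℝ) :
    psiStar φ l ≠ ⊤ := by
  have h1 : ∀ᶠ x : ℝ in atTop, ENNReal.ofReal (|l|) < φ x / ENNReal.ofReal x :=
    hdphi.eventually (lt_mem_nhds ENNReal.ofReal_lt_top)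
  obtain ⟨R, hR⟩ := (h1.and (eventually_gt_atTop 0)).exists_forall_of_atTop
  have h2 : (⨆ x : ℝ, ((x * l : ℝ) : EReal) - ((φ (x + 1) : ℝ≥0∞) : EReal)) ≤
      (((|R| + 1) * |l| : ℝ) : EReal) := by
    refine iSup_le fun x => ?_
    by_cases hx : φ (x + 1) = ⊤
    · simp [hx]
    rw [← EReal.coe_ennreal_toReal hx, ← EReal.coe_sub, EReal.coe_le_coe_iff]
    have hx0 : 0 ≤ x + 1 := by
      by_contra hc
      exact hx (hneg _ (not_le.mp hc))
    have hp : 0 ≤ (φ (x+1)).toReal := ENNReal.toReal_nonneg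
    have ha : 0 ≤ |l| := abs_nonneg l
    have hb : l ≤ |l| := le_abs_self l
    have hb' : -l ≤ |l| := neg_le_abs l
    have hRa : R ≤ |R| := le_abs_self R
    have hRb : 0 ≤ |R| := abs_nonneg R
    have hxl : (x + 1) * l ≤ (x + 1) * |l| := mul_le_mul_of_nonneg_left hb hx0
    by_cases hxR : R ≤ x + 1
    · obtain ⟨h3, h4⟩ := hR _ hxR
      have h5 : ENNReal.ofReal |l| * ENNReal.ofReal (x + 1) ≤ φ (x + 1) := by
        have := (ENNReal.le_div_iff_mul_le (Or.inl (by simpa using h4))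
          (Or.inl ENNReal.ofReal_ne_top)).1 h3.le
        exact this
      rw [← ENNReal.ofReal_mul ha] at h5
      have h6 := (ENNReal.ofReal_le_iff_le_toReal hx).1 h5
      nlinarith [mul_nonneg hRb ha]
    · push Not at hxR
      have : (x + 1) * |l| ≤ |R| * |l| := mul_le_mul_of_nonneg_right (by linarith) ha
      nlinarith
  have h3 := EReal.toENNReal_le_toENNReal h2
  rw [EReal.toENNReal_of_ne_top (EReal.coe_ne_top _)] at h3
  exact ne_top_of_le_ne_top ENNReal.ofReal_ne_top h3

theorem komlos_aux {Ω : Type*} [MeasurableSpace Ω] (ν : Measure Ω) [IsProbabilityMeasure ν]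
    (S : ℕ → Set (Ω → ℝ)) (anti : Antitone S) (ne : ∀ n, (S n).Nonempty)
    (hmeas : ∀ n, ∀ f ∈ S n, Measurable f) (hpos : ∀ n, ∀ f ∈ S n, ∀ ω, 0 ≤ f ω)
    (mid : ∀ n, ∀ f ∈ S n, ∀ h ∈ S n, (fun ω => (f ω + h ω) / 2) ∈ S n)
    (hint : ∀ n, ∀ f ∈ S n, ∫⁻ ω, ENNReal.ofReal (f ω) ∂ν ≤ 1) :
    ∃ h : ℕ → Ω → ℝ, (∀ n, h n ∈ S n) ∧ ∃ H : Ω → ℝ, Measurable H ∧ (∀ ω, 0 ≤ H ω) ∧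
      (∀ᵐ ω ∂ν, Tendsto (fun n => h n ω) atTop (𝓝 (H ω))) ∧
      ∫⁻ ω, ENNReal.ofReal (H ω) ∂ν ≤ 1 := by
  let I : (Ω → ℝ) → ℝ := fun f => ∫ ω, Real.exp (-f ω) ∂ν
  have hIint : ∀ n, ∀ f ∈ S n, Integrable (fun ω => Real.exp (-f ω)) ν := by
    intro n f hf
    have := hmeas n f hf
    refine Integrable.of_bound (by fun_prop) 1 (ae_of_all _ fun ω => ?_)
    rw [Real.norm_eq_abs, abs_of_pos (Real.exp_pos _)]
    exact Real.exp_le_one_iff.2 (by linarith [hpos n f hf ω])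
  have hI0 : ∀ f, 0 ≤ I f := fun f => integral_nonneg fun ω => (Real.exp_pos _).le
  have hI1 : ∀ n, ∀ f ∈ S n, I f ≤ 1 := by
    intro n f hf
    have : I f ≤ ∫ _, (1:ℝ) ∂ν := integral_mono (hIint n f hf) (integrable_const _)
      fun ω => Real.exp_le_one_iff.2 (by linarith [hpos n f hf ω])
    simpa using this
  let J : ℕ → ℝ := fun n => sInf (I '' S n)
  have hbdd : ∀ n, BddBelow (I '' S n) := fun n => ⟨0, by rintro _ ⟨f, _, rfl⟩; exact hI0 f⟩
  have hJle : ∀ n, ∀ f ∈ S n, J n ≤ I f := fun n f hf => csInf_le (hbdd n) ⟨f, hf, rfl⟩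
  have hJmono : Monotone J := fun n m hnm =>
    csInf_le_csInf (hbdd n) ((ne m).image _) (image_mono (anti hnm))
  have hJb : BddAbove (range J) := ⟨1, by
    rintro _ ⟨n, rfl⟩
    obtain ⟨f, hf⟩ := ne n
    exact (hJle n f hf).trans (hI1 n f hf)⟩
  have hJlim := tendsto_atTop_ciSup hJmono hJb
  set Jl := ⨆ n, J n with hJl
  have hJl' : ∀ n, J n ≤ Jl := fun n => le_ciSup hJb n
  have hch : ∀ n : ℕ, ∃ f ∈ S n, I f < J n + 1 / ((n:ℝ) + 1) := by
    intro n
    obtain ⟨_, ⟨f, hf, rfl⟩, h⟩ := exists_lt_of_csInf_lt ((ne n).image I)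
      (show sInf (I '' S n) < J n + 1 / ((n:ℝ) + 1) by
        have : (0:ℝ) < 1 / ((n:ℝ) + 1) := by positivity
        change J n < _
        linarith)
    exact ⟨f, hf, h⟩
  choose f hfS hfI using hch
  let b : ℕ → ℝ := fun N => 2 * (Jl - J N) + 2 * (1 / ((N:ℝ) + 1))
  have hb0 : Tendsto b atTop (𝓝 0) := by
    have h1 := ((hJlim.const_sub Jl).const_mul 2).add
      ((tendsto_one_div_add_atTop_nhds_zero_nat (𝕜 := ℝ)).const_mul 2)
    simpa [b] using h1
  let u : ℕ → Ω → ℝ := fun n ω => Real.exp (-f n ω / 2)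
  have hum : ∀ n, Measurable (u n) := fun n => by
    have := hmeas n _ (hfS n)
    fun_prop
  have hu1 : ∀ n ω, u n ω ≤ 1 := fun n ω =>
    Real.exp_le_one_iff.2 (by linarith [hpos n _ (hfS n) ω])
  have hu0 : ∀ n ω, 0 < u n ω := fun n ω => Real.exp_pos _
  have hkey : ∀ N n m, N ≤ n → N ≤ m → ∫ ω, (u n ω - u m ω) ^ 2 ∂ν ≤ b N := by
    intro N n m hn hm
    have hnS := anti hn (hfS n)
    have hmS := anti hm (hfS m)
    have hmid := mid N _ hnS _ hmS
    have e : (fun ω => (u n ω - u m ω) ^ 2) = fun ω => Real.exp (-f n ω) + Real.exp (-f m ω)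
        - 2 * Real.exp (-((f n ω + f m ω) / 2)) := by
      funext ω
      have e1 : Real.exp (-f n ω) = u n ω * u n ω := by
        simp only [u]; rw [← Real.exp_add]; ring_nf
      have e2 : Real.exp (-f m ω) = u m ω * u m ω := by
        simp only [u]; rw [← Real.exp_add]; ring_nf
      have e3 : Real.exp (-((f n ω + f m ω) / 2)) = u n ω * u m ω := by
        simp only [u]; rw [← Real.exp_add]; ring_nf
      rw [e1, e2, e3]; ring
    have e' : ∫ ω, (u n ω - u m ω) ^ 2 ∂ν = I (f n) + I (f m)
        - 2 * I (fun ω => (f n ω + f m ω) / 2) := by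
      rw [e, integral_sub, integral_add, integral_const_mul]
      · exact hIint _ _ hnS
      · exact hIint _ _ hmS
      · exact (hIint _ _ hnS).add (hIint _ _ hmS)
      · exact (hIint _ _ hmid).const_mul 2
    rw [e']
    have a1 := hJle N _ hmid
    have a2 := hfI n
    have a3 := hfI m
    have a4 := hJl' n
    have a5 := hJl' m
    have a6 := Nat.one_div_le_one_div (α := ℝ) hn
    have a7 := Nat.one_div_le_one_div (α := ℝ) hm
    simp only [b]
    linarith
  have hev : ∀ N : ℕ, ∀ᶠ k in atTop, b k < ((1/2:ℝ)^N)^2 := fun N =>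
    hb0.eventually (gt_mem_nhds (by positivity))
  obtain ⟨k, hk, hkb⟩ := extraction_forall_of_eventually hev
  have hae : ∀ᵐ ω ∂ν, ∃ l : ℝ, Tendsto (fun n => u (k n) ω) atTop (𝓝 l) := by
    refine Lp.ae_tendsto_of_cauchy_eLpNorm (p := 2) (B := fun N => (2⁻¹ : ℝ≥0∞)^N)
      (fun n => (hum _).aestronglyMeasurable) (by norm_num) ?_ ?_
    · rw [ENNReal.tsum_geometric]; simp
    · intro N n m hn hm
      have hL : MemLp (u (k n) - u (k m)) 2 ν := by
        refine MemLp.of_bound ((hum _).sub (hum _)).aestronglyMeasurable 1 (ae_of_all _ fun ω => ?_)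
        rw [Real.norm_eq_abs, abs_le, Pi.sub_apply]
        constructor <;> linarith [hu1 (k n) ω, hu0 (k n) ω, hu1 (k m) ω, hu0 (k m) ω]
      rw [hL.eLpNorm_eq_integral_rpow_norm (by norm_num) (by norm_num)]
      have e : ∫ ω, ‖(u (k n) - u (k m)) ω‖ ^ (2:ℝ≥0∞).toReal ∂ν
          = ∫ ω, (u (k n) ω - u (k m) ω) ^ 2 ∂ν := by
        congr 1; funext ω; simp
      rw [e]
      have h1 : ∫ ω, (u (k n) ω - u (k m) ω) ^ 2 ∂ν < ((1/2:ℝ)^N)^2 :=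
        (hkey (k N) _ _ (hk.monotone hn) (hk.monotone hm)).trans_lt (hkb N)
      have h2 : (2⁻¹ : ℝ≥0∞)^N = ENNReal.ofReal ((1/2:ℝ)^N) := by
        rw [ENNReal.ofReal_pow (by norm_num), one_div, ENNReal.ofReal_inv_of_pos (by norm_num)]
        simp
      rw [h2, ENNReal.ofReal_lt_ofReal_iff (by positivity)]
      have h3 : (2:ℝ≥0∞).toReal⁻¹ = 1/2 := by simp
      rw [h3, ← Real.sqrt_eq_rpow]
      exact (Real.sqrt_lt' (by positivity)).2 h1
  have hF : ∫⁻ ω, liminf (fun n => ENNReal.ofReal (f (k n) ω)) atTop ∂ν ≤ 1 := by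
    refine (lintegral_liminf_le fun n => (hmeas _ _ (hfS (k n))).ennreal_ofReal).trans ?_
    refine liminf_le_of_frequently_le' (Frequently.of_forall fun n => hint _ _ (hfS (k n)))
  have hfin : ∀ᵐ ω ∂ν, liminf (fun n => ENNReal.ofReal (f (k n) ω)) atTop < ⊤ := by
    refine ae_lt_top (Measurable.liminf fun n => (hmeas _ _ (hfS (k n))).ennreal_ofReal) ?_
    exact ne_top_of_le_ne_top ENNReal.one_ne_top hF
  have hfu : ∀ n ω, f n ω = -2 * Real.log (u n ω) := fun n ω => by
    simp only [u, Real.log_exp]; ring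
  have hae2 : ∀ᵐ ω ∂ν, ∃ l : ℝ, Tendsto (fun n => f (k n) ω) atTop (𝓝 l) := by
    filter_upwards [hae, hfin] with ω ⟨l, hl⟩ hω
    have hl0 : 0 ≤ l := ge_of_tendsto' hl fun n => (hu0 _ _).le
    rcases hl0.eq_or_lt with h0 | h0
    · exfalso
      subst h0
      have h1 : Tendsto (fun n => u (k n) ω) atTop (𝓝[>] 0) :=
        tendsto_nhdsWithin_iff.2 ⟨hl, Eventually.of_forall fun n => hu0 _ _⟩
      have h2 := Real.tendsto_log_nhdsGT_zero.comp h1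
      have h3 : Tendsto (fun n => f (k n) ω) atTop atTop := by
        have := h2.const_mul_atBot_of_neg (show (-2:ℝ) < 0 by norm_num)
        refine this.congr fun n => ?_
        rw [hfu]; rfl
      have h4 := (ENNReal.tendsto_ofReal_atTop.comp h3).liminf_eq
      have h5 : liminf (fun n => ENNReal.ofReal (f (k n) ω)) atTop = ⊤ := h4
      exact hω.ne h5
    · refine ⟨-2 * Real.log l, ?_⟩
      have := (hl.log h0.ne').const_mul (-2)
      exact this.congr fun n => (hfu _ _).symm
  obtain ⟨H, hHm, hH⟩ := measurable_limit_of_tendsto_metrizable_ae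
    (fun n => (hmeas _ _ (hfS (k n))).aemeasurable) hae2
  refine ⟨fun n => f (k n), fun n => anti hk.le_apply (hfS _), fun ω => max (H ω) 0,
    hHm.max measurable_const, fun ω => le_max_right _ _, ?_, ?_⟩
  · filter_upwards [hH] with ω hω
    have : 0 ≤ H ω := ge_of_tendsto' hω fun n => hpos _ _ (hfS (k n)) ω
    rwa [max_eq_left this]
  · refine le_trans (lintegral_mono_ae ?_) hF
    filter_upwards [hH] with ω hω
    have : 0 ≤ H ω := ge_of_tendsto' hω fun n => hpos _ _ (hfS (k n)) ω
    rw [max_eq_left this]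
    exact ((ENNReal.continuous_ofReal.tendsto _).comp hω).liminf_eq.ge

theorem integrable_of_psiStar {Ω : Type*} [MeasurableSpace Ω] (φ : ℝ → ℝ≥0∞)
    (hdom : (1 : ℝ) ∈ interior {x : ℝ | φ x ≠ ⊤})
    (ν : Measure Ω) [IsProbabilityMeasure ν] (l : Ω → ℝ) (hl : Measurable l)
    (hfin : ∫⁻ ω, psiStar φ (l ω) ∂ν ≠ ⊤) : Integrable l ν := by
  obtain ⟨r, hr, hball⟩ := Metric.mem_nhds_iff.1 (mem_interior_iff_mem_nhds.1 hdom)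
  have h1 : φ (1 + r / 2) ≠ ⊤ := hball (by
    rw [Metric.mem_ball, Real.dist_eq, add_sub_cancel_left, abs_of_pos (by positivity)]; linarith)
  have h2 : φ (1 - r / 2) ≠ ⊤ := hball (by
    rw [Metric.mem_ball, Real.dist_eq, abs_lt]; constructor <;> linarith)
  have h3 : ∀ ω, ENNReal.ofReal (r / 2 * |l ω|) ≤
      (φ (1 + r / 2) + φ (1 - r / 2)) + psiStar φ (l ω) := by
    intro ω
    rcases abs_cases (l ω) with ⟨h, _⟩ | ⟨h, _⟩
    · have := psiStar_young φ (1 + r / 2) (l ω)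
      rw [h, add_right_comm]
      refine le_trans ?_ (this.trans le_self_add)
      rw [add_sub_cancel_left]
    · have := psiStar_young φ (1 - r / 2) (l ω)
      rw [h, add_assoc]
      refine le_trans ?_ (this.trans le_add_self)
      apply le_of_eq; congr 1; ring
  have h4 : ∫⁻ ω, ENNReal.ofReal (r / 2 * |l ω|) ∂ν ≠ ⊤ := by
    refine ne_top_of_le_ne_top ?_ (lintegral_mono h3)
    rw [lintegral_add_left measurable_const]
    simp [h1, h2, hfin]
  have h5 : Integrable (fun ω => r / 2 * l ω) ν := by
    refine ⟨by fun_prop, ?_⟩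
    rw [hasFiniteIntegral_iff_norm]
    refine lt_of_le_of_lt (lintegral_mono fun ω => ?_) h4.lt_top
    rw [norm_mul, Real.norm_eq_abs, Real.norm_eq_abs, abs_of_pos (by positivity : 0 < r/2)]
  have h6 := h5.const_mul (2 / r)
  refine h6.congr (ae_of_all _ fun ω => ?_)
  field_simp

theorem fatou_young {Ω : Type*} [MeasurableSpace Ω] (φ : ℝ → ℝ≥0∞) (hφ : Measurable φ)
    (hfin : ∀ y, psiStar φ y ≠ ⊤)
    (ν : Measure Ω) [IsProbabilityMeasure ν] (l : Ω → ℝ) (hl : Measurable l)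
    (hli : Integrable l ν)
    (hpl : ∫⁻ ω, psiStar φ (l ω) ∂ν ≠ ⊤)
    (h : ℕ → Ω → ℝ) (hm : ∀ n, Measurable (h n)) (H : Ω → ℝ)
    (hH : ∀ᵐ ω ∂ν, Tendsto (fun n => h n ω) atTop (𝓝 (H ω)))
    (hhl : ∀ n, Integrable (fun ω => h n ω * l ω) ν)
    (hHl : Integrable (fun ω => H ω * l ω) ν)
    (C : ℝ) (hC : ∀ n, ∫⁻ ω, φ (h n ω) ∂ν ≤ ENNReal.ofReal C) (hC0 : 0 ≤ C)
    (m : ℝ) (hlim : Tendsto (fun n => ∫ ω, h n ω * l ω ∂ν) atTop (𝓝 m)) :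
    m - ∫ ω, H ω * l ω ∂ν ≤ C := by
  set p : Ω → ℝ := fun ω => (psiStar φ (l ω)).toReal with hp
  have hpm : Measurable p := ((psiStar_measurable φ).comp hl).ennreal_toReal
  have hpi : Integrable p ν :=
    integrable_toReal_of_lintegral_ne_top ((psiStar_measurable φ).comp hl).aemeasurable hpl
  have hqn : ∀ n, ∫⁻ ω, φ (h n ω) ∂ν ≠ ⊤ := fun n =>
    ne_top_of_le_ne_top ENNReal.ofReal_ne_top (hC n)
  have hqm : ∀ n, Measurable fun ω => φ (h n ω) := fun n => hφ.comp (hm n)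
  have hqi : ∀ n, Integrable (fun ω => (φ (h n ω)).toReal) ν := fun n =>
    integrable_toReal_of_lintegral_ne_top (hqm n).aemeasurable (hqn n)
  have hqt : ∀ n, ∀ᵐ ω ∂ν, φ (h n ω) < ⊤ := fun n => ae_lt_top (hqm n) (hqn n)
  have hqC : ∀ n, ∫ ω, (φ (h n ω)).toReal ∂ν ≤ C := fun n => by
    rw [integral_toReal (hqm n).aemeasurable (hqt n)]
    exact ENNReal.toReal_le_of_le_ofReal hC0 (hC n)
  set k : ℕ → Ω → ℝ := fun n ω => (φ (h n ω)).toReal + p ω - (h n ω * l ω - l ω) with hk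
  have hki : ∀ n, Integrable (k n) ν := fun n => ((hqi n).add hpi).sub ((hhl n).sub hli)
  have hk0 : ∀ n, 0 ≤ᵐ[ν] k n := fun n => by
    filter_upwards [hqt n] with ω hω
    have h1 := psiStar_young φ (h n ω) (l ω)
    have h2 : φ (h n ω) + psiStar φ (l ω) ≠ ⊤ := ENNReal.add_ne_top.2 ⟨hω.ne, hfin _⟩
    have h3 := (ENNReal.ofReal_le_iff_le_toReal h2).1 h1
    rw [ENNReal.toReal_add hω.ne (hfin _)] at h3
    simp only [hk, hp, Pi.zero_apply]
    linarith
  have hkI : ∀ n, ∫ ω, k n ω ∂ν ≤ C + ∫ ω, p ω ∂ν - (∫ ω, h n ω * l ω ∂ν - ∫ ω, l ω ∂ν) := by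
    intro n
    have : ∫ ω, k n ω ∂ν = (∫ ω, (φ (h n ω)).toReal ∂ν) + ∫ ω, p ω ∂ν
        - (∫ ω, h n ω * l ω ∂ν - ∫ ω, l ω ∂ν) := by
      rw [← integral_sub (hhl n) hli, ← integral_add (hqi n) hpi, ← integral_sub]
      · exact (hqi n).add hpi
      · exact (hhl n).sub hli
    rw [this]
    linarith [hqC n]
  have hlim2 : Tendsto (fun n => C + ∫ ω, p ω ∂ν - (∫ ω, h n ω * l ω ∂ν - ∫ ω, l ω ∂ν)) atTop
      (𝓝 (C + ∫ ω, p ω ∂ν - (m - ∫ ω, l ω ∂ν))) := (hlim.sub_const _).const_sub _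
  set w : Ω → ℝ := fun ω => p ω - (H ω * l ω - l ω) with hw
  have hwi : Integrable w ν := hpi.sub (hHl.sub hli)
  have hkm : ∀ n, Measurable (k n) := fun n => by
    have := hm n
    have := (hqm n).ennreal_toReal
    fun_prop
  have hle : ∫⁻ ω, ENNReal.ofReal (w ω) ∂ν ≤
      ENNReal.ofReal (C + ∫ ω, p ω ∂ν - (m - ∫ ω, l ω ∂ν)) := by
    calc ∫⁻ ω, ENNReal.ofReal (w ω) ∂ν
        ≤ ∫⁻ ω, liminf (fun n => ENNReal.ofReal (k n ω)) atTop ∂ν := by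
          refine lintegral_mono_ae ?_
          filter_upwards [hH] with ω hω
          have h1 : Tendsto (fun n => ENNReal.ofReal (p ω - (h n ω * l ω - l ω))) atTop
              (𝓝 (ENNReal.ofReal (w ω))) :=
            (ENNReal.continuous_ofReal.tendsto _).comp
              (((hω.mul_const _).sub_const _).const_sub _)
          rw [← h1.liminf_eq]
          refine liminf_le_liminf (Eventually.of_forall fun n => ?_)
          refine ENNReal.ofReal_le_ofReal ?_
          have : 0 ≤ (φ (h n ω)).toReal := ENNReal.toReal_nonneg
          simp only [hk]; linarith
      _ ≤ liminf (fun n => ∫⁻ ω, ENNReal.ofReal (k n ω) ∂ν) atTop :=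
          lintegral_liminf_le fun n => (hkm n).ennreal_ofReal
      _ ≤ liminf (fun n => ENNReal.ofReal
            (C + ∫ ω, p ω ∂ν - (∫ ω, h n ω * l ω ∂ν - ∫ ω, l ω ∂ν))) atTop := by
          refine liminf_le_liminf (Eventually.of_forall fun n => ?_)
          rw [← ofReal_integral_eq_lintegral_ofReal (hki n) (hk0 n)]
          exact ENNReal.ofReal_le_ofReal (hkI n)
      _ = _ := ((ENNReal.continuous_ofReal.tendsto _).comp hlim2).liminf_eq
  have hnn : 0 ≤ C + ∫ ω, p ω ∂ν - (m - ∫ ω, l ω ∂ν) :=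
    ge_of_tendsto' hlim2 fun n => (integral_nonneg_of_ae (hk0 n)).trans (hkI n)
  have hwle : ∫ ω, w ω ∂ν ≤ C + ∫ ω, p ω ∂ν - (m - ∫ ω, l ω ∂ν) := by
    have h1 : ∫ ω, w ω ∂ν ≤ ∫ ω, max (w ω) 0 ∂ν :=
      integral_mono hwi hwi.pos_part fun ω => le_max_left _ _
    refine h1.trans ?_
    rw [integral_eq_lintegral_of_nonneg_ae (f := fun ω => max (w ω) 0)
      (ae_of_all _ fun ω => le_max_right _ _) hwi.pos_part.aestronglyMeasurable]
    refine ENNReal.toReal_le_of_le_ofReal hnn (le_trans (le_of_eq ?_) hle)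
    refine lintegral_congr fun ω => ?_
    rcases le_total (w ω) 0 with h | h
    · rw [max_eq_right h, ENNReal.ofReal_of_nonpos h, ENNReal.ofReal_zero]
    · rw [max_eq_left h]
  have hwe : ∫ ω, w ω ∂ν = ∫ ω, p ω ∂ν - (∫ ω, H ω * l ω ∂ν - ∫ ω, l ω ∂ν) := by
    rw [← integral_sub hHl hli, ← integral_sub hpi]
    exact hHl.sub hli
  linarith

theorem eq_zero_of_forall_mul_le (d C : ℝ) (h : ∀ t : ℝ, t * d ≤ C) : d = 0 := by
  by_contra hd
  have := h ((C + 1) / d)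
  rw [div_mul_cancel₀ _ hd] at this
  linarith

/-- **Lower semicontinuity of the optimal lower bound function for strongly
subexponential functions.**  Assume `φ'(∞) = ∞`.  If `g` is measurable with
`Λ_{g,ν}(t) < ∞` for every `t ∈ ℝ` (strongly `(φ,ν)`-subexponential), then
`ε ↦ inf { D_φ(μ‖ν) : μ probability, μ ≪ ν, g ∈ L¹(μ), ∫ g dμ − ∫ g dν = ε }`
is lower semicontinuous on `ℝ`. -/
theorem lower_bound_lsc_of_strongly_subexponential {Ω : Type*} [MeasurableSpace Ω]
    (φ : ℝ → ℝ≥0∞)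
    (hconv : ∀ x y : ℝ, ∀ a b : ℝ≥0, a + b = 1 →
      φ ((a : ℝ) * x + (b : ℝ) * y) ≤ (a : ℝ≥0∞) * φ x + (b : ℝ≥0∞) * φ y)
    (hlsc : LowerSemicontinuous φ)
    (hneg : ∀ x : ℝ, x < 0 → φ x = ⊤)
    (hone : φ 1 = 0)
    (hdom : (1 : ℝ) ∈ interior {x : ℝ | φ x ≠ ⊤})
    (hdphi : Tendsto (fun x : ℝ => φ x / ENNReal.ofReal x) atTop (𝓝 ⊤))
    (ν : Measure Ω) [IsProbabilityMeasure ν]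
    (g : Ω → ℝ) (hg : Measurable g)
    (hstrong : ∀ t : ℝ, cgf φ ν g t ≠ ⊤) :
    LowerSemicontinuous (fun ε : ℝ =>
      ⨅ (μ : Measure Ω) (_ : IsProbabilityMeasure μ ∧ μ ≪ ν ∧ Integrable g μ ∧
          ∫ ω, g ω ∂μ - ∫ ω, g ω ∂ν = ε), divAC φ μ ν) := by
  have hφ : Measurable φ := hlsc.measurable
  have hfin := psiStar_ne_top φ hneg hdphi
  have hex : ∀ t : ℝ, ∃ lam : ℝ, ∫⁻ ω, psiStar φ (t * g ω + lam) ∂ν ≠ ⊤ := by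
    intro t
    by_contra hc
    push Not at hc
    exact hstrong t (by simp [cgf, hc])
  choose lam hlam using hex
  have hlint : ∀ t, Integrable (fun ω => t * g ω + lam t) ν := fun t =>
    integrable_of_psiStar φ hdom ν _ (by fun_prop) (hlam t)
  intro ε₀ y hy
  by_contra hcon
  rw [not_eventually] at hcon
  refine absurd hy (not_lt.2 ?_)
  have hyt : y ≠ ⊤ := (lt_of_lt_of_le hy le_top).ne
  clear hy
  set c := ∫ ω, g ω ∂ν with hc
  let S : ℕ → Set (Ω → ℝ) := fun n => {f | Measurable f ∧ (∀ ω, 0 ≤ f ω) ∧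
    ∫⁻ ω, ENNReal.ofReal (f ω) ∂ν = 1 ∧ ∫⁻ ω, φ (f ω) ∂ν ≤ y + ENNReal.ofReal (1 / ((n:ℝ) + 1)) ∧
    Integrable (fun ω => f ω * g ω) ν ∧ |∫ ω, f ω * g ω ∂ν - (c + ε₀)| ≤ 1 / ((n:ℝ) + 1)}
  have hSint : ∀ n, ∀ f ∈ S n, Integrable f ν := by
    rintro n f ⟨h1, h2, h3, -⟩
    refine ⟨h1.aestronglyMeasurable, ?_⟩
    rw [hasFiniteIntegral_iff_ofReal (ae_of_all _ h2), h3]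
    exact ENNReal.one_lt_top
  have hSint1 : ∀ n, ∀ f ∈ S n, ∫ ω, f ω ∂ν = 1 := by
    rintro n f ⟨h1, h2, h3, -⟩
    rw [integral_eq_lintegral_of_nonneg_ae (ae_of_all _ h2) h1.aestronglyMeasurable, h3]
    simp
  have hanti : Antitone S := by
    rintro n m hnm f ⟨h1, h2, h3, h4, h5, h6⟩
    have := Nat.one_div_le_one_div (α := ℝ) hnm
    exact ⟨h1, h2, h3, h4.trans (by gcongr), h5, h6.trans this⟩
  have hne : ∀ n, (S n).Nonempty := by
    intro n
    have hn : (0:ℝ) < 1 / ((n:ℝ) + 1) := by positivity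
    obtain ⟨ε, hε1, hε2⟩ := (hcon.and_eventually (Metric.ball_mem_nhds ε₀ hn)).exists
    have hlt : (⨅ (μ : Measure Ω) (_ : IsProbabilityMeasure μ ∧ μ ≪ ν ∧ Integrable g μ ∧
          ∫ ω, g ω ∂μ - c = ε), divAC φ μ ν) < y + ENNReal.ofReal (1 / ((n:ℝ) + 1)) :=
      (not_lt.1 hε1).trans_lt (ENNReal.lt_add_right hyt (by simpa using hn))
    obtain ⟨μ, hμ⟩ := iInf_lt_iff.1 hlt
    obtain ⟨⟨hμp, hac, hgi, hgε⟩, hD⟩ := iInf_lt_iff.1 hμ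
    refine ⟨fun ω => (μ.rnDeriv ν ω).toReal, (μ.measurable_rnDeriv ν).ennreal_toReal,
      fun ω => ENNReal.toReal_nonneg, ?_, hD.le, (integrable_rnDeriv_smul_iff hac).2 hgi, ?_⟩
    · have : ∫⁻ ω, ENNReal.ofReal (μ.rnDeriv ν ω).toReal ∂ν = ∫⁻ ω, μ.rnDeriv ν ω ∂ν := by
        refine lintegral_congr_ae ?_
        filter_upwards [μ.rnDeriv_lt_top ν] with ω hω
        exact ENNReal.ofReal_toReal hω.ne
      rw [this, Measure.lintegral_rnDeriv hac]
      simp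
    · have := integral_rnDeriv_smul (f := g) hac
      simp only [smul_eq_mul] at this
      rw [this]
      rw [Real.dist_eq] at hε2
      have e : ∫ ω, g ω ∂μ - (c + ε₀) = ε - ε₀ := by linarith
      rw [e]; exact hε2.le
  have hmid : ∀ n, ∀ f ∈ S n, ∀ h ∈ S n, (fun ω => (f ω + h ω) / 2) ∈ S n := by
    rintro n f hf h hh
    obtain ⟨f1, f2, f3, f4, f5, f6⟩ := id hf
    obtain ⟨h1, h2, h3, h4, h5, h6⟩ := id hh
    have hmi : Integrable (fun ω => (f ω + h ω) / 2) ν :=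
      ((hSint n f hf).add (hSint n h hh)).div_const 2
    have hm0 : ∀ ω, 0 ≤ (f ω + h ω) / 2 := fun ω => by linarith [f2 ω, h2 ω]
    have e : (fun ω => (f ω + h ω) / 2 * g ω) = fun ω => (f ω * g ω + h ω * g ω) / 2 := by
      funext ω; ring
    refine ⟨by fun_prop, hm0, ?_, ?_, ?_, ?_⟩
    · rw [← ofReal_integral_eq_lintegral_ofReal hmi (ae_of_all _ hm0), integral_div,
        integral_add (hSint n f hf) (hSint n h hh), hSint1 n f hf, hSint1 n h hh]
      norm_num
    · set B := y + ENNReal.ofReal (1 / ((n:ℝ) + 1))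
      have half : ((1/2 : ℝ≥0) : ℝ≥0∞) + ((1/2 : ℝ≥0) : ℝ≥0∞) = 1 := by
        rw [← ENNReal.coe_add, add_halves]; rfl
      calc ∫⁻ ω, φ ((f ω + h ω) / 2) ∂ν
          ≤ ∫⁻ ω, ((1/2 : ℝ≥0) : ℝ≥0∞) * φ (f ω) + ((1/2 : ℝ≥0) : ℝ≥0∞) * φ (h ω) ∂ν := by
            refine lintegral_mono fun ω => ?_
            have := hconv (f ω) (h ω) (1/2) (1/2) (add_halves 1)
            refine le_trans (le_of_eq ?_) this
            congr 1; push_cast; ring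
        _ = ((1/2 : ℝ≥0) : ℝ≥0∞) * ∫⁻ ω, φ (f ω) ∂ν
            + ((1/2 : ℝ≥0) : ℝ≥0∞) * ∫⁻ ω, φ (h ω) ∂ν := by
            have mf : Measurable fun ω => φ (f ω) := hφ.comp f1
            have mh : Measurable fun ω => φ (h ω) := hφ.comp h1
            rw [lintegral_add_left (mf.const_mul _), lintegral_const_mul _ mf,
              lintegral_const_mul _ mh]
        _ ≤ ((1/2 : ℝ≥0) : ℝ≥0∞) * B + ((1/2 : ℝ≥0) : ℝ≥0∞) * B := by gcongr
        _ = B := by rw [← add_mul, half, one_mul]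
    · rw [e]; exact (f5.add h5).div_const 2
    · rw [e, integral_div, integral_add f5 h5]
      rw [abs_le] at *
      constructor <;> linarith [f6.1, f6.2, h6.1, h6.2]
  obtain ⟨h, hhS, H, hHm, hH0, hHlim, hH1⟩ := komlos_aux ν S hanti hne (fun n f hf => hf.1)
    (fun n f hf => hf.2.1) hmid (fun n f hf => hf.2.2.1.le)
  have hHi : Integrable H ν := by
    refine ⟨hHm.aestronglyMeasurable, ?_⟩
    rw [hasFiniteIntegral_iff_ofReal (ae_of_all _ hH0)]
    exact hH1.trans_lt ENNReal.one_lt_top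
  -- divergence bound
  have hHD : ∫⁻ ω, φ (H ω) ∂ν ≤ y := by
    calc ∫⁻ ω, φ (H ω) ∂ν ≤ ∫⁻ ω, liminf (fun n => φ (h n ω)) atTop ∂ν := by
          refine lintegral_mono_ae ?_
          filter_upwards [hHlim] with ω hω
          refine le_of_forall_lt fun a ha => ?_
          obtain ⟨b, hab, hb⟩ := exists_between ha
          refine hab.trans_le (le_liminf_of_le (by isBoundedDefault) ?_)
          filter_upwards [hω.eventually (hlsc (H ω) b hb)] with n hn using hn.le
      _ ≤ liminf (fun n => ∫⁻ ω, φ (h n ω) ∂ν) atTop :=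
          lintegral_liminf_le fun n => hφ.comp (hhS n).1
      _ ≤ liminf (fun n : ℕ => y + ENNReal.ofReal (1 / ((n:ℝ) + 1))) atTop :=
          liminf_le_liminf (Eventually.of_forall fun n => (hhS n).2.2.2.1)
      _ = y := by
          have h1 := (ENNReal.continuous_ofReal.tendsto _).comp
            (tendsto_one_div_add_atTop_nhds_zero_nat (𝕜 := ℝ))
          have h2 := h1.const_add y
          rw [ENNReal.ofReal_zero, add_zero] at h2
          exact h2.liminf_eq
  set C : ℝ := y.toReal + 1 with hCdef
  have hC0 : 0 ≤ C := by positivity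
  have hC : ∀ n, ∫⁻ ω, φ (h n ω) ∂ν ≤ ENNReal.ofReal C := fun n => by
    refine (hhS n).2.2.2.1.trans ?_
    rw [hCdef, ENNReal.ofReal_add ENNReal.toReal_nonneg zero_le_one, ENNReal.ofReal_toReal hyt]
    have : 1 / ((n:ℝ) + 1) ≤ 1 := by
      rw [div_le_one (by positivity)]; linarith [(Nat.cast_nonneg n : (0:ℝ) ≤ n)]
    gcongr
  -- mass
  have hmass : ∫ ω, H ω ∂ν = 1 := by
    have := eq_zero_of_forall_mul_le (1 - ∫ ω, H ω ∂ν) C fun t => by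
      have key := fatou_young φ hφ hfin ν (fun _ => t) measurable_const (integrable_const t)
        (by simp [hfin]) h (fun n => (hhS n).1) H hHlim
        (fun n => (hSint n _ (hhS n)).mul_const t) (hHi.mul_const t) C hC hC0 t
        (by
          refine tendsto_const_nhds.congr fun n => ?_
          rw [integral_mul_const, hSint1 n _ (hhS n), one_mul])
      rw [integral_mul_const] at key
      linarith
    linarith
  -- integrability of g
  have hgν : Integrable g ν := by
    have h1 := (hlint 1).sub (integrable_const (lam 1))
    refine h1.congr (ae_of_all _ fun ω => ?_)
    simp
  have hHg : Integrable (fun ω => H ω * g ω) ν := by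
    have h1 : Integrable (fun ω => (H ω - 1) * g ω) ν := by
      refine ⟨by fun_prop, ?_⟩
      rw [hasFiniteIntegral_iff_norm]
      set L : ℝ := |lam 1| + |lam (-1)| with hL
      have hb : ∀ ω, ENNReal.ofReal ‖(H ω - 1) * g ω‖ ≤ φ (H ω) +
          (psiStar φ (1 * g ω + lam 1) + (psiStar φ ((-1) * g ω + lam (-1)) +
            ENNReal.ofReal (L * |H ω - 1|))) := by
        intro ω
        have y1 := psiStar_young φ (H ω) (1 * g ω + lam 1)
        have y2 := psiStar_young φ (H ω) ((-1) * g ω + lam (-1))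
        have b1 : -((H ω - 1) * lam 1) ≤ L * |H ω - 1| := by
          refine (neg_le_abs _).trans ?_
          rw [abs_mul, mul_comm]
          gcongr
          linarith [abs_nonneg (lam (-1))]
        have b2 : -((H ω - 1) * lam (-1)) ≤ L * |H ω - 1| := by
          refine (neg_le_abs _).trans ?_
          rw [abs_mul, mul_comm]
          gcongr
          linarith [abs_nonneg (lam 1)]
        rw [Real.norm_eq_abs]
        rcases abs_cases ((H ω - 1) * g ω) with ⟨e, _⟩ | ⟨e, _⟩
        · calc ENNReal.ofReal |(H ω - 1) * g ω|
              ≤ ENNReal.ofReal ((H ω - 1) * (1 * g ω + lam 1) + L * |H ω - 1|) :=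
                ENNReal.ofReal_le_ofReal (by rw [e]; linarith)
            _ ≤ ENNReal.ofReal ((H ω - 1) * (1 * g ω + lam 1)) + ENNReal.ofReal (L * |H ω - 1|) :=
                ENNReal.ofReal_add_le
            _ ≤ (φ (H ω) + psiStar φ (1 * g ω + lam 1)) + ENNReal.ofReal (L * |H ω - 1|) := by
                gcongr
            _ ≤ _ := by
                rw [add_assoc]; gcongr; exact le_add_self
        · calc ENNReal.ofReal |(H ω - 1) * g ω|
              ≤ ENNReal.ofReal ((H ω - 1) * ((-1) * g ω + lam (-1)) + L * |H ω - 1|) :=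
                ENNReal.ofReal_le_ofReal (by rw [e]; linarith)
            _ ≤ ENNReal.ofReal ((H ω - 1) * ((-1) * g ω + lam (-1)))
                + ENNReal.ofReal (L * |H ω - 1|) :=
                ENNReal.ofReal_add_le
            _ ≤ (φ (H ω) + psiStar φ ((-1) * g ω + lam (-1))) + ENNReal.ofReal (L * |H ω - 1|) := by
                gcongr
            _ ≤ _ := by
                rw [add_assoc]; exact add_le_add_right le_add_self _
      refine lt_of_le_of_lt (lintegral_mono hb) ?_
      have mψ : ∀ t, Measurable fun ω => psiStar φ (t * g ω + lam t) := fun t =>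
        (psiStar_measurable φ).comp (by fun_prop)
      have mH : Measurable fun ω => φ (H ω) := hφ.comp hHm
      rw [lintegral_add_left mH, lintegral_add_left (mψ 1), lintegral_add_left (mψ (-1))]
      have hlast : ∫⁻ ω, ENNReal.ofReal (L * |H ω - 1|) ∂ν < ⊤ := by
        have hi : Integrable (fun ω => L * |H ω - 1|) ν :=
          ((hHi.sub (integrable_const 1)).abs).const_mul L
        have hL0 : 0 ≤ L := by positivity
        exact (hasFiniteIntegral_iff_ofReal (ae_of_all _ fun ω => by positivity)).1 hi.2
      exact ENNReal.add_lt_top.2 ⟨hHD.trans_lt hyt.lt_top, ENNReal.add_lt_top.2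
        ⟨(hlam 1).lt_top, ENNReal.add_lt_top.2 ⟨(hlam (-1)).lt_top, hlast⟩⟩⟩
    refine (h1.add hgν).congr (ae_of_all _ fun ω => ?_)
    simp only [Pi.add_apply]; ring
  -- moment
  have hmom : ∫ ω, H ω * g ω ∂ν = c + ε₀ := by
    have hgl : Tendsto (fun n => ∫ ω, h n ω * g ω ∂ν) atTop (𝓝 (c + ε₀)) := by
      rw [tendsto_iff_dist_tendsto_zero]
      refine squeeze_zero (fun n => dist_nonneg) (fun n => ?_)
        (tendsto_one_div_add_atTop_nhds_zero_nat (𝕜 := ℝ))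
      rw [Real.dist_eq]
      exact (hhS n).2.2.2.2.2
    have := eq_zero_of_forall_mul_le ((c + ε₀) - ∫ ω, H ω * g ω ∂ν) C fun t => by
      have gen : ∀ f : Ω → ℝ, Integrable f ν → Integrable (fun ω => f ω * g ω) ν →
          Integrable (fun ω => f ω * (t * g ω + lam t)) ν ∧
          ∫ ω, f ω * (t * g ω + lam t) ∂ν = t * (∫ ω, f ω * g ω ∂ν) + lam t * ∫ ω, f ω ∂ν := by
        intro f hf hfg
        have e : (fun ω => f ω * (t * g ω + lam t))
            = fun ω => t * (f ω * g ω) + lam t * f ω := by funext ω; ring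
        rw [e]
        refine ⟨(hfg.const_mul t).add (hf.const_mul _), ?_⟩
        rw [integral_add (hfg.const_mul t) (hf.const_mul _), integral_const_mul, integral_const_mul]
      have key := fatou_young φ hφ hfin ν (fun ω => t * g ω + lam t) (by fun_prop) (hlint t)
        (hlam t) h (fun n => (hhS n).1) H hHlim
        (fun n => (gen _ (hSint n _ (hhS n)) (hhS n).2.2.2.2.1).1) (gen H hHi hHg).1 C hC hC0
        (t * (c + ε₀) + lam t)
        (by
          refine ((hgl.const_mul t).add_const (lam t)).congr fun n => ?_
          rw [(gen _ (hSint n _ (hhS n)) (hhS n).2.2.2.2.1).2, hSint1 n _ (hhS n), mul_one])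
      rw [(gen H hHi hHg).2, hmass] at key
      linarith
    linarith
  -- the limit measure
  have hden : Measurable fun ω => ENNReal.ofReal (H ω) := hHm.ennreal_ofReal
  have hden_top : ∀ᵐ ω ∂ν, ENNReal.ofReal (H ω) < ⊤ := ae_of_all _ fun ω => ENNReal.ofReal_lt_top
  have htr : ∀ ω, (ENNReal.ofReal (H ω)).toReal = H ω := fun ω => ENNReal.toReal_ofReal (hH0 ω)
  refine iInf₂_le_of_le (ν.withDensity fun ω => ENNReal.ofReal (H ω)) ⟨⟨?_⟩, ?_, ?_, ?_⟩ ?_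
  · rw [withDensity_apply _ MeasurableSet.univ, Measure.restrict_univ,
      ← ofReal_integral_eq_lintegral_ofReal hHi (ae_of_all _ hH0), hmass, ENNReal.ofReal_one]
  · exact withDensity_absolutelyContinuous _ _
  · rw [integrable_withDensity_iff_integrable_smul' hden hden_top]
    simpa only [htr, smul_eq_mul] using hHg
  · rw [integral_withDensity_eq_integral_toReal_smul hden hden_top]
    simp only [htr, smul_eq_mul]
    rw [hmom]; ring
  · refine le_trans (le_of_eq ?_) hHD
    refine lintegral_congr_ae ?_
    filter_upwards [Measure.rnDeriv_withDensity ν hden] with ω hω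
    rw [hω, htr]
end

section
/- Assume that 1 is not in the interior of the set {x ∈ ℝ : φ(x) = 0}. Then for every probability measure ν on (Ω,F) and every measurable g : Ω → ℝ, the following are equivalent: (i) there exists δ > 0 such that Λ_{g,ν}(t) < ∞ for every t with |t| < δ; (ii) { x ∈ ℝ : for all t ∈ ℝ, Λ_{g,ν}(t) ≥ t·x } = {0} (i.e., the subdifferential of Λ_{g,ν} at 0 is {0}, equivalently Λ_{g,ν} is differentiable at 0 with derivative 0). -/
open MeasureTheory Filter Set
open scoped ENNReal NNReal Topology

/-- Truncated conjugate of a `ℝ≥0∞`-valued function. -/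
noncomputable def conjF (ρ : ℝ → ℝ≥0∞) (y : ℝ) : ℝ≥0∞ :=
  ⨆ x : ℝ, (ENNReal.ofReal (x * y) - ρ x)

theorem erealToENNReal_eq (x : EReal) : erealToENNReal x = x.toENNReal := rfl

theorem psiStar_eq (φ : ℝ → ℝ≥0∞) (y : ℝ) :
    psiStar φ y = conjF (fun x => φ (x + 1)) y := by
  rw [psiStar, erealToENNReal_eq, conjF]
  have hterm : ∀ x : ℝ, (((x * y : ℝ) : EReal) - ((φ (x + 1) : ℝ≥0∞) : EReal)).toENNReal
      = ENNReal.ofReal (x * y) - φ (x + 1) := by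
    intro x
    rw [EReal.toENNReal_sub (EReal.coe_ennreal_nonneg _), EReal.real_coe_toENNReal,
      EReal.toENNReal_coe]
  apply le_antisymm
  · rw [← EReal.toENNReal_coe (x := ⨆ x : ℝ, _)]
    refine EReal.toENNReal_le_toENNReal (iSup_le fun x => ?_)
    have h2 : ENNReal.ofReal (x * y) - φ (x + 1) ≤
        ⨆ x : ℝ, (ENNReal.ofReal (x * y) - φ (x + 1)) :=
      le_iSup (fun x : ℝ => ENNReal.ofReal (x * y) - φ (x + 1)) x
    refine le_trans ?_ (EReal.coe_ennreal_le_coe_ennreal_iff.2 h2)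
    rw [← hterm x, EReal.coe_toENNReal_eq_max]
    exact le_max_right _ _
  · refine iSup_le fun x => ?_
    rw [← hterm x]
    exact EReal.toENNReal_le_toENNReal
      (le_iSup (fun x : ℝ => ((x * y : ℝ) : EReal) - ((φ (x + 1) : ℝ≥0∞) : EReal)) x)

theorem conjF_zero (ρ : ℝ → ℝ≥0∞) : conjF ρ 0 = 0 := by
  simp [conjF]

theorem conjF_neg (ρ : ℝ → ℝ≥0∞) (y : ℝ) : conjF (fun x => ρ (-x)) y = conjF ρ (-y) := by
  unfold conjF
  refine (Equiv.neg ℝ).iSup_congr fun x => ?_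
  simp

theorem conjF_convex (ρ : ℝ → ℝ≥0∞) (y z s : ℝ) (hs : 0 ≤ s) (hs1 : s ≤ 1) :
    conjF ρ (s * y + (1 - s) * z) ≤
      ENNReal.ofReal s * conjF ρ y + ENNReal.ofReal (1 - s) * conjF ρ z := by
  have h1s : 0 ≤ 1 - s := by linarith
  refine iSup_le fun x => ?_
  rw [tsub_le_iff_right]
  have hy : ENNReal.ofReal (x * y) ≤ conjF ρ y + ρ x :=
    tsub_le_iff_right.1 (le_iSup (fun x => ENNReal.ofReal (x * y) - ρ x) x)
  have hz : ENNReal.ofReal (x * z) ≤ conjF ρ z + ρ x :=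
    tsub_le_iff_right.1 (le_iSup (fun x => ENNReal.ofReal (x * z) - ρ x) x)
  have hsum : ENNReal.ofReal s + ENNReal.ofReal (1 - s) = 1 := by
    rw [← ENNReal.ofReal_add hs h1s]; simp
  calc ENNReal.ofReal (x * (s * y + (1 - s) * z))
      = ENNReal.ofReal (s * (x * y) + (1 - s) * (x * z)) := by congr 1; ring
    _ ≤ ENNReal.ofReal (s * (x * y)) + ENNReal.ofReal ((1 - s) * (x * z)) :=
        ENNReal.ofReal_add_le
    _ = ENNReal.ofReal s * ENNReal.ofReal (x * y)
        + ENNReal.ofReal (1 - s) * ENNReal.ofReal (x * z) := by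
        rw [ENNReal.ofReal_mul hs, ENNReal.ofReal_mul h1s]
    _ ≤ ENNReal.ofReal s * (conjF ρ y + ρ x) + ENNReal.ofReal (1 - s) * (conjF ρ z + ρ x) := by
        gcongr
    _ = ENNReal.ofReal s * conjF ρ y + ENNReal.ofReal (1 - s) * conjF ρ z
        + (ENNReal.ofReal s + ENNReal.ofReal (1 - s)) * ρ x := by ring
    _ = _ := by rw [hsum, one_mul]

theorem conjF_measurable (ρ : ℝ → ℝ≥0∞) : Measurable (conjF ρ) := by
  refine measurable_of_Iic fun c => ?_
  have : OrdConnected (conjF ρ ⁻¹' Iic c) := by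
    refine Convex.ordConnected (𝕜 := ℝ) ?_
    intro y hy z hz a b ha hb hab
    obtain rfl : b = 1 - a := by linarith
    simp only [mem_preimage, mem_Iic, smul_eq_mul] at *
    refine (conjF_convex ρ y z a ha (by linarith)).trans ?_
    calc _ ≤ ENNReal.ofReal a * c + ENNReal.ofReal (1 - a) * c := by gcongr
      _ = c := by rw [← add_mul, ← ENNReal.ofReal_add ha hb]; simp
  exact this.measurableSet

theorem conjF_scale (ρ : ℝ → ℝ≥0∞) (y s : ℝ) (hs : 0 ≤ s) (hs1 : s ≤ 1) :
    conjF ρ (s * y) ≤ conjF ρ y := by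
  have h := conjF_convex ρ y 0 s hs hs1
  rw [conjF_zero, mul_zero, mul_zero, add_zero, add_zero] at h
  refine h.trans ?_
  calc _ ≤ 1 * conjF ρ y := by gcongr; simpa using hs1
    _ = _ := one_mul _

theorem conjF_mono (ρ : ℝ → ℝ≥0∞) (y z : ℝ) (hy : 0 ≤ y) (hyz : y ≤ z) :
    conjF ρ y ≤ conjF ρ z := by
  rcases hy.eq_or_lt with rfl | h
  · simp [conjF_zero]
  have hz : 0 < z := by linarith
  have := conjF_scale ρ z (y / z) (by positivity) (by rw [div_le_one hz]; exact hyz)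
  rwa [div_mul_cancel₀ _ hz.ne'] at this

theorem conjF_small (ρ : ℝ → ℝ≥0∞) (hρ0 : ρ 0 = 0)
    (hρ : ∀ x y : ℝ, ∀ a b : ℝ≥0, a + b = 1 →
      ρ ((a : ℝ) * x + (b : ℝ) * y) ≤ (a : ℝ≥0∞) * ρ x + (b : ℝ≥0∞) * ρ y)
    (hpos : ∀ u : ℝ, 0 < u → ρ u ≠ 0) (ε : ℝ) (hε : 0 < ε) :
    ∃ δ : ℝ, 0 < δ ∧ ∀ z : ℝ, 0 ≤ z → z ≤ δ → conjF ρ z ≤ ENNReal.ofReal (ε * z) := by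
  obtain ⟨m, hm0, hm⟩ : ∃ m : ℝ≥0, 0 < m ∧ (m : ℝ≥0∞) < ρ ε := by
    obtain ⟨m, hm0, hm⟩ := ENNReal.lt_iff_exists_nnreal_btwn.1 (pos_iff_ne_zero.2 (hpos ε hε))
    exact ⟨m, by exact_mod_cast hm0, hm⟩
  have hm0' : (0 : ℝ) < m := hm0
  refine ⟨m / ε, by positivity, fun z hz hzδ => iSup_le fun x => ?_⟩
  rw [tsub_le_iff_right]
  rcases le_or_gt x ε with hx | hx
  · exact (ENNReal.ofReal_le_ofReal (by gcongr)).trans le_self_add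
  · refine le_trans ?_ le_add_self
    have hx0 : 0 < x := hε.trans hx
    have hq : ε / x ≤ 1 := by rw [div_le_one hx0]; exact hx.le
    have h := hρ x 0 (ε / x).toNNReal (1 - ε / x).toNNReal (by
      rw [← Real.toNNReal_add (by positivity) (by linarith)]; simp)
    rw [hρ0, mul_zero, mul_zero, add_zero, add_zero, Real.coe_toNNReal _ (by positivity),
      div_mul_cancel₀ _ hx0.ne'] at h
    have h2 : (m : ℝ≥0∞) ≤ ENNReal.ofReal (ε / x) * ρ x := hm.le.trans h
    have h3 : ENNReal.ofReal (x / ε) * m ≤ ρ x := by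
      calc _ ≤ ENNReal.ofReal (x / ε) * (ENNReal.ofReal (ε / x) * ρ x) := by gcongr
        _ = ρ x := by
          rw [← mul_assoc, ← ENNReal.ofReal_mul (by positivity)]
          rw [show x / ε * (ε / x) = 1 by field_simp]; simp
    refine le_trans ?_ h3
    rw [← ENNReal.ofReal_coe_nnreal, ← ENNReal.ofReal_mul (by positivity)]
    apply ENNReal.ofReal_le_ofReal
    calc x * z ≤ x * (m / ε) := by gcongr
      _ = _ := by ring

/-- The abstract generating function. -/
noncomputable def cgfF {Ω : Type*} [MeasurableSpace Ω] (ρ : ℝ → ℝ≥0∞)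
    (ν : Measure Ω) (g : Ω → ℝ) (t : ℝ) : ℝ≥0∞ :=
  ⨅ lam : ℝ, ∫⁻ ω, conjF ρ (t * g ω + lam) ∂ν

theorem cgfF_neg {Ω : Type*} [MeasurableSpace Ω] (ρ : ℝ → ℝ≥0∞)
    (ν : Measure Ω) (g : Ω → ℝ) (t : ℝ) : cgfF ρ ν g (-t) = cgfF ρ ν (fun ω => - g ω) t := by
  simp [cgfF]

theorem cgfF_refl {Ω : Type*} [MeasurableSpace Ω] (ρ : ℝ → ℝ≥0∞)
    (ν : Measure Ω) (g : Ω → ℝ) (t : ℝ) :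
    cgfF (fun x => ρ (-x)) ν (fun ω => - g ω) t = cgfF ρ ν g t := by
  unfold cgfF
  refine (Equiv.neg ℝ).iInf_congr fun x => ?_
  refine lintegral_congr fun ω => ?_
  rw [conjF_neg]
  simp only [Equiv.neg_apply]
  congr 1; ring

theorem cgfF_scale {Ω : Type*} [MeasurableSpace Ω] (ρ : ℝ → ℝ≥0∞)
    (ν : Measure Ω) (g : Ω → ℝ) (t s : ℝ) (hs : 0 ≤ s) (hs1 : s ≤ 1) :
    cgfF ρ ν g (s * t) ≤ cgfF ρ ν g t := by
  refine le_iInf fun lam => (iInf_le _ (s * lam)).trans ?_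
  refine lintegral_mono fun ω => ?_
  have := conjF_scale ρ (t * g ω + lam) s hs hs1
  rwa [mul_add, ← mul_assoc] at this

theorem cgfF_small {Ω : Type*} [MeasurableSpace Ω] (ρ : ℝ → ℝ≥0∞)
    (hsm : ∀ ε : ℝ, 0 < ε →
      ∃ δ : ℝ, 0 < δ ∧ ∀ z : ℝ, 0 ≤ z → z ≤ δ → conjF ρ z ≤ ENNReal.ofReal (ε * z))
    (ν : Measure Ω) [IsProbabilityMeasure ν] (g : Ω → ℝ) (hg : Measurable g)
    (t₁ : ℝ) (ht₁ : 0 < t₁) (hfin : cgfF ρ ν g t₁ ≠ ⊤) (ε : ℝ) (hε : 0 < ε) :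
    ∃ t : ℝ, 0 < t ∧ cgfF ρ ν g t < ENNReal.ofReal (ε * t) := by
  obtain ⟨l, hl⟩ : ∃ l : ℝ, ∫⁻ ω, conjF ρ (t₁ * g ω + l) ∂ν ≠ ⊤ := by
    by_contra! h
    exact hfin (by simp [cgfF, h])
  -- choice of the times
  have hch : ∀ n : ℕ, ∃ t : ℝ, 0 < t ∧ t ≤ t₁ / 2 ∧ (0 < n →
      conjF ρ (4 * n * t) ≤ ENNReal.ofReal (t / n)) := by
    intro n
    rcases Nat.eq_zero_or_pos n with rfl | hn
    · exact ⟨t₁ / 2, by positivity, le_rfl, by simp⟩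
    have hn' : (0 : ℝ) < n := by exact_mod_cast hn
    obtain ⟨δ, hδ, h⟩ := hsm (1 / (4 * n * n)) (by positivity)
    refine ⟨min (t₁ / 2) (δ / (4 * n)), by positivity, min_le_left _ _, fun _ => ?_⟩
    set t := min (t₁ / 2) (δ / (4 * n)) with ht
    have ht0 : 0 < t := by positivity
    have htd : t ≤ δ / (4 * n) := min_le_right _ _
    rw [le_div_iff₀ (by positivity)] at htd
    refine (h (4 * n * t) (by positivity) (by linarith)).trans ?_
    apply ENNReal.ofReal_le_ofReal
    apply le_of_eq; field_simp
  choose t ht0 htle htf using hch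
  have hmeas : Measurable (conjF ρ) := conjF_measurable ρ
  have key : Tendsto (fun n : ℕ => ∫⁻ ω, ENNReal.ofReal (1 / t n) *
      conjF ρ (t n * g ω + t n * n) ∂ν) atTop (𝓝 (∫⁻ _, 0 ∂ν)) := by
    refine tendsto_lintegral_filter_of_dominated_convergence
      (fun ω => ENNReal.ofReal (1 / t₁) * conjF ρ (t₁ * g ω + l) + 1) ?_ ?_ ?_ ?_
    · refine Eventually.of_forall fun n => ?_
      exact (hmeas.comp (by fun_prop)).const_mul _
    · obtain ⟨N, hN⟩ := exists_nat_gt (|l| / t₁)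
      filter_upwards [eventually_ge_atTop (max N 1)] with n hn
      refine Eventually.of_forall fun ω => ?_
      have hn1 : 1 ≤ n := (le_max_right _ _).trans hn
      have hn1' : (1 : ℝ) ≤ n := by exact_mod_cast hn1
      have hnN : (N : ℝ) ≤ n := by exact_mod_cast (le_max_left _ _).trans hn
      have hln : |l| ≤ n * t₁ := by
        have : |l| / t₁ ≤ n := by linarith
        rwa [div_le_iff₀ ht₁] at this
      have hl1 := le_abs_self l
      have hl2 := neg_abs_le l
      have htn := ht0 n
      set s := t n / t₁ with hs
      have hs0 : 0 < s := by positivity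
      have hs2 : s ≤ 1 / 2 := by
        rw [hs, div_le_iff₀ ht₁]; linarith [htle n]
      have hst : t n = s * t₁ := by rw [hs]; field_simp
      set z := s * (n * t₁ - l) / (1 - s) with hz
      have h1s : 0 < 1 - s := by linarith
      have hz0 : 0 ≤ z := by
        apply div_nonneg _ h1s.le
        apply mul_nonneg hs0.le; linarith
      have hz1 : z ≤ 4 * n * t n := by
        rw [hz, div_le_iff₀ h1s, hst]
        have h1 : s * (n * t₁ - l) ≤ s * (2 * (n * t₁)) := by gcongr; linarith
        have h2 : 0 ≤ s * (n * t₁) * (1 / 2 - s) := by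
          apply mul_nonneg (by positivity); linarith
        nlinarith
      have hc := conjF_convex ρ (t₁ * g ω + l) z s hs0.le (by linarith)
      have harg : s * (t₁ * g ω + l) + (1 - s) * z = t n * g ω + t n * n := by
        rw [hz, mul_div_cancel₀ _ h1s.ne', hst]; ring
      rw [harg] at hc
      calc ENNReal.ofReal (1 / t n) * conjF ρ (t n * g ω + t n * n)
          ≤ ENNReal.ofReal (1 / t n) * (ENNReal.ofReal s * conjF ρ (t₁ * g ω + l)
            + ENNReal.ofReal (1 - s) * conjF ρ z) := by gcongr
        _ ≤ ENNReal.ofReal (1 / t n) * (ENNReal.ofReal s * conjF ρ (t₁ * g ω + l)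
            + 1 * ENNReal.ofReal (t n)) := by
            gcongr
            · rw [ENNReal.ofReal_le_one]; linarith
            · refine (conjF_mono ρ z _ hz0 hz1).trans ((htf n hn1).trans ?_)
              apply ENNReal.ofReal_le_ofReal
              exact div_le_self htn.le hn1'
        _ = _ := by
            rw [mul_add, ← mul_assoc, one_mul, ← ENNReal.ofReal_mul (by positivity),
              ← ENNReal.ofReal_mul (by positivity)]
            congr 3
            · rw [hs]; field_simp
            · rw [one_div_mul_cancel htn.ne']; simp
    · rw [lintegral_add_right _ measurable_const,
        lintegral_const_mul' _ _ ENNReal.ofReal_ne_top]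
      simp only [lintegral_const, measure_univ, mul_one]
      exact ENNReal.add_ne_top.2 ⟨ENNReal.mul_ne_top ENNReal.ofReal_ne_top hl, by simp⟩
    · refine Eventually.of_forall fun ω => ?_
      have hlim : Tendsto (fun n : ℕ => ENNReal.ofReal (1 / (n : ℝ))) atTop (𝓝 0) := by
        have := ENNReal.tendsto_ofReal (tendsto_one_div_atTop_nhds_zero_nat (𝕜 := ℝ))
        simpa using this
      refine tendsto_of_tendsto_of_tendsto_of_le_of_le' tendsto_const_nhds hlim
        (Eventually.of_forall fun _ => zero_le) ?_
      obtain ⟨N, hN⟩ := exists_nat_gt (|g ω|)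
      filter_upwards [eventually_ge_atTop (max N 1)] with n hn
      have hn1 : 1 ≤ n := (le_max_right _ _).trans hn
      have hn1' : (1 : ℝ) ≤ n := by exact_mod_cast hn1
      have hnN : (N : ℝ) ≤ n := by exact_mod_cast (le_max_left _ _).trans hn
      have hl1 := le_abs_self (g ω)
      have hl2 := neg_abs_le (g ω)
      have htn := ht0 n
      have e : t n * g ω + t n * n = t n * (g ω + n) := by ring
      have hb : conjF ρ (t n * g ω + t n * n) ≤ ENNReal.ofReal (t n / n) := by
        refine (conjF_mono ρ _ (4 * n * t n) ?_ ?_).trans (htf n hn1)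
        · rw [e]; apply mul_nonneg htn.le; linarith
        · rw [e, mul_comm (4 * (n : ℝ))]; gcongr; linarith
      calc _ ≤ ENNReal.ofReal (1 / t n) * ENNReal.ofReal (t n / n) := by gcongr
        _ = _ := by
          rw [← ENNReal.ofReal_mul (by positivity)]
          congr 1; field_simp
  rw [lintegral_zero] at key
  obtain ⟨n, hn⟩ := (key.eventually_lt_const (ENNReal.ofReal_pos.2 hε)).exists
  refine ⟨t n, ht0 n, ?_⟩
  have htn := ht0 n
  refine lt_of_le_of_lt (iInf_le _ (t n * n)) ?_
  rw [lintegral_const_mul' _ _ ENNReal.ofReal_ne_top, one_div, ENNReal.ofReal_inv_of_pos htn,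
    mul_comm, ← div_eq_mul_inv, ENNReal.div_lt_iff (by simp [htn]) (by simp)] at hn
  rwa [ENNReal.ofReal_mul hε.le]

/-- Version for either side of strict positivity. -/
theorem cgfF_small' {Ω : Type*} [MeasurableSpace Ω] (ρ : ℝ → ℝ≥0∞) (hρ0 : ρ 0 = 0)
    (hρ : ∀ x y : ℝ, ∀ a b : ℝ≥0, a + b = 1 →
      ρ ((a : ℝ) * x + (b : ℝ) * y) ≤ (a : ℝ≥0∞) * ρ x + (b : ℝ≥0∞) * ρ y)
    (hpos : (∀ u : ℝ, 0 < u → ρ u ≠ 0) ∨ (∀ u : ℝ, 0 < u → ρ (-u) ≠ 0))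
    (ν : Measure Ω) [IsProbabilityMeasure ν] (g : Ω → ℝ) (hg : Measurable g)
    (t₁ : ℝ) (ht₁ : 0 < t₁) (hfin : cgfF ρ ν g t₁ ≠ ⊤) (ε : ℝ) (hε : 0 < ε) :
    ∃ t : ℝ, 0 < t ∧ cgfF ρ ν g t < ENNReal.ofReal (ε * t) := by
  rcases hpos with h | h
  · exact cgfF_small ρ (conjF_small ρ hρ0 hρ h) ν g hg t₁ ht₁ hfin ε hε
  · have := cgfF_small (fun x => ρ (-x)) (conjF_small (fun x => ρ (-x)) (by simpa using hρ0)
      (fun x y a b hab => by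
        have := hρ (-x) (-y) a b hab
        convert this using 2; ring) h) ν (fun ω => - g ω) hg.neg t₁ ht₁
        (by rwa [cgfF_refl]) ε hε
    simpa only [cgfF_refl] using this

theorem coe_real_le_iff (r : ℝ) (x : ℝ≥0∞) :
    ((r : ℝ) : EReal) ≤ (x : EReal) ↔ ENNReal.ofReal r ≤ x := by
  constructor
  · intro h
    have := EReal.toENNReal_le_toENNReal h
    rwa [EReal.real_coe_toENNReal, EReal.toENNReal_coe] at this
  · intro h
    refine le_trans ?_ (EReal.coe_ennreal_le_coe_ennreal_iff.2 h)
    rw [← EReal.real_coe_toENNReal, EReal.coe_toENNReal_eq_max]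
    exact le_max_right _ _

/-- **Continuity of `Λ_{g,ν}` at `0` is equivalent to differentiability at `0` with
derivative `0`.**  Assume `1` is not in the interior of `{x : φ(x) = 0}`.  Then for every
probability measure `ν` and measurable `g`, `Λ_{g,ν}` is finite on a neighborhood of `0`
if and only if `{x : ∀ t, t·x ≤ Λ_{g,ν}(t)} = {0}` (the subdifferential of `Λ_{g,ν}` at
`0` is `{0}`). -/
theorem cgf_finite_iff_subdifferential_zero {Ω : Type*} [MeasurableSpace Ω]
    (φ : ℝ → ℝ≥0∞)
    (hconv : ∀ x y : ℝ, ∀ a b : ℝ≥0, a + b = 1 →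
      φ ((a : ℝ) * x + (b : ℝ) * y) ≤ (a : ℝ≥0∞) * φ x + (b : ℝ≥0∞) * φ y)
    (hlsc : LowerSemicontinuous φ)
    (hneg : ∀ x : ℝ, x < 0 → φ x = ⊤)
    (hone : φ 1 = 0)
    (hdom : (1 : ℝ) ∈ interior {x : ℝ | φ x ≠ ⊤})
    (hnotflat : (1 : ℝ) ∉ interior {x : ℝ | φ x = 0})
    (ν : Measure Ω) [IsProbabilityMeasure ν]
    (g : Ω → ℝ) (hg : Measurable g) :
    (∃ δ : ℝ, 0 < δ ∧ ∀ t : ℝ, |t| < δ → cgf φ ν g t ≠ ⊤)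
    ↔ {x : ℝ | ∀ t : ℝ, ((t * x : ℝ) : EReal) ≤ ((cgf φ ν g t : ℝ≥0∞) : EReal)} = {0} := by
  have hC : cgf φ ν g = cgfF (fun x => φ (x + 1)) ν g := by
    funext t
    simp only [cgf, cgfF, psiStar_eq φ]
  rw [hC]
  simp only [coe_real_le_iff]
  set ρ : ℝ → ℝ≥0∞ := fun x => φ (x + 1) with hρdef
  have hρ0 : ρ 0 = 0 := by simp [hρdef, hone]
  have hρ : ∀ x y : ℝ, ∀ a b : ℝ≥0, a + b = 1 →
      ρ ((a : ℝ) * x + (b : ℝ) * y) ≤ (a : ℝ≥0∞) * ρ x + (b : ℝ≥0∞) * ρ y := by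
    intro x y a b hab
    have h := hconv (x + 1) (y + 1) a b hab
    have hab' : (a : ℝ) + b = 1 := by exact_mod_cast hab
    have e : (a : ℝ) * (x + 1) + b * (y + 1) = a * x + b * y + 1 := by
      linear_combination hab'
    rwa [e] at h
  have hpos : (∀ u : ℝ, 0 < u → ρ u ≠ 0) ∨ (∀ u : ℝ, 0 < u → ρ (-u) ≠ 0) := by
    by_contra! hcon
    obtain ⟨⟨u, hu, hu0⟩, v, hv, hv0⟩ := hcon
    apply hnotflat
    rw [mem_interior]
    refine ⟨Ioo (1 - v) (1 + u), ?_, isOpen_Ioo, by constructor <;> linarith⟩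
    intro x hx
    have huv : 0 < u + v := by linarith
    have hx1 : 0 ≤ 1 + u - x := by linarith [hx.2]
    have hx2 : 0 ≤ x - 1 + v := by linarith [hx.1]
    have h := hρ u (-v) ((x - 1 + v) / (u + v)).toNNReal ((1 + u - x) / (u + v)).toNNReal (by
      rw [← Real.toNNReal_add (by positivity) (by positivity), ← add_div,
        show x - 1 + v + (1 + u - x) = u + v by ring, div_self huv.ne', Real.toNNReal_one])
    rw [hu0, hv0, mul_zero, mul_zero, add_zero, Real.coe_toNNReal _ (by positivity),
      Real.coe_toNNReal _ (by positivity)] at h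
    have e : (x - 1 + v) / (u + v) * u + (1 + u - x) / (u + v) * -v = x - 1 := by
      field_simp; ring
    rw [e] at h
    simpa [hρdef] using h
  constructor
  · rintro ⟨δ, hδ, hfin⟩
    ext x
    simp only [mem_ofPred_eq, mem_singleton_iff]
    constructor
    · intro hx
      rcases lt_trichotomy x 0 with h | h | h
      · exfalso
        obtain ⟨t, ht, hlt⟩ := cgfF_small' ρ hρ0 hρ hpos ν (fun ω => - g ω) hg.neg (δ / 2)
          (by positivity) (by
            rw [← cgfF_neg]; apply hfin; rw [abs_neg, abs_of_pos] <;> linarith) (-x) (by linarith)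
        rw [← cgfF_neg] at hlt
        have := hx (-t)
        rw [show -t * x = -x * t by ring] at this
        exact absurd hlt (not_lt.2 this)
      · exact h
      · exfalso
        obtain ⟨t, ht, hlt⟩ := cgfF_small' ρ hρ0 hρ hpos ν g hg (δ / 2)
          (by positivity) (by apply hfin; rw [abs_of_pos] <;> linarith) x h
        have := hx t
        rw [mul_comm] at this
        exact absurd hlt (not_lt.2 this)
    · rintro rfl t
      simp
  · intro hset
    have h1 : (1 : ℝ) ∉ {x : ℝ | ∀ t : ℝ, ENNReal.ofReal (t * x) ≤ cgfF ρ ν g t} := by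
      rw [hset]; simp
    have h2 : (-1 : ℝ) ∉ {x : ℝ | ∀ t : ℝ, ENNReal.ofReal (t * x) ≤ cgfF ρ ν g t} := by
      rw [hset]; simp
    simp only [mem_ofPred_eq, not_forall, not_le] at h1 h2
    obtain ⟨t, ht⟩ := h1
    obtain ⟨r, hr⟩ := h2
    have ht0 : 0 < t := by
      have := ENNReal.ofReal_pos.1 (lt_of_le_of_lt (zero_le) ht); linarith
    have hr0 : r < 0 := by
      have := ENNReal.ofReal_pos.1 (lt_of_le_of_lt (zero_le) hr); linarith
    refine ⟨min t (-r), lt_min ht0 (by linarith), fun s hs => ?_⟩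
    rw [lt_min_iff, abs_lt, abs_lt] at hs
    rcases le_total 0 s with h | h
    · have := cgfF_scale ρ ν g t (s / t) (by positivity) (by
        rw [div_le_one ht0]; linarith [hs.1.2])
      rw [div_mul_cancel₀ _ ht0.ne'] at this
      exact (this.trans_lt (ht.trans ENNReal.ofReal_lt_top)).ne
    · have := cgfF_scale ρ ν g r (s / r) (div_nonneg_of_nonpos h hr0.le) (by
        rw [div_le_one_of_neg hr0]; linarith [hs.2.1])
      rw [div_mul_cancel₀ _ hr0.ne] at this
      exact (this.trans_lt (hr.trans ENNReal.ofReal_lt_top)).ne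
end
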